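/- For every μ ∈ P_2(ℝ), the log-concave Wasserstein projection μ̂ = proj_{F_lc} μ has the same mean as μ: ∫_ℝ x dμ̂(x) = ∫_ℝ x dμ(x); equivalently, ∫_0^1 Q_μ̂(u) du = ∫_0^1 Q_μ(u) du. -/

import Mathlib

open MeasureTheory Set Filter

noncomputable def quantile (μ : MeasureTheory.Measure ℝ) (u : ℝ) : ℝ :=
  sInf {x : ℝ | u ≤ (μ (Set.Iic x)).toReal}

def HasFiniteMomentP (p : ℝ) (μ : MeasureTheory.Measure ℝ) : Prop :=
  MeasureTheory.IsProbabilityMeasure μ ∧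
    MeasureTheory.Integrable (fun x => |x| ^ p) μ

noncomputable def Wdist (p : ℝ) (μ ν : MeasureTheory.Measure ℝ) : ℝ :=
  (∫ u in Set.Ioo (0:ℝ) 1, |quantile μ u - quantile ν u| ^ p) ^ (1 / p)

def DisplacementConvex (F : Set (MeasureTheory.Measure ℝ)) : Prop :=
  ∀ μ ∈ F, ∀ ν ∈ F, ∀ t ∈ Set.Icc (0:ℝ) 1, ∃ σ ∈ F,
    ∀ u ∈ Set.Ioo (0:ℝ) 1,
      quantile σ u = (1 - t) * quantile μ u + t * quantile ν u

def WClosed (p : ℝ) (F : Set (MeasureTheory.Measure ℝ)) : Prop :=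
  ∀ (μs : ℕ → MeasureTheory.Measure ℝ) (μ : MeasureTheory.Measure ℝ),
    (∀ n, μs n ∈ F) → HasFiniteMomentP p μ →
    Filter.Tendsto (fun n => Wdist p (μs n) μ) Filter.atTop (nhds 0) → μ ∈ F

/-- A Borel probability measure on `ℝ` is log-concave if it is a point mass, or it has a
density `f` with respect to Lebesgue measure such that `log f : ℝ → [−∞, ∞)` is concave;
the latter is expressed by the multiplicative inequality
`f((1−t)x + ty) ≥ f(x)^(1−t) · f(y)^t`. -/
def IsLogConcave (μ : MeasureTheory.Measure ℝ) : Prop :=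
  (∃ x : ℝ, μ = MeasureTheory.Measure.dirac x) ∨
  ∃ f : ℝ → ℝ, (∀ x, 0 ≤ f x) ∧
    μ = MeasureTheory.volume.withDensity (fun x => ENNReal.ofReal (f x)) ∧
    ∀ x y : ℝ, ∀ t ∈ Set.Icc (0:ℝ) 1,
      f x ^ (1 - t) * f y ^ t ≤ f ((1 - t) * x + t * y)

/-- The set `F_lc` of log-concave probability measures on `ℝ`. -/
def Flc : Set (MeasureTheory.Measure ℝ) :=
  {μ | MeasureTheory.IsProbabilityMeasure μ ∧ IsLogConcave μ}

section Quantile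

variable {μ : Measure ℝ}

theorem bddBelow_setOf_le_measure_Iic [IsProbabilityMeasure μ] {u : ℝ} (hu : 0 < u) :
    BddBelow {x : ℝ | u ≤ (μ (Iic x)).toReal} := by
  have h := (ProbabilityTheory.tendsto_cdf_atBot μ).eventually_lt_const hu
  obtain ⟨a, ha⟩ := eventually_atBot.1 h
  refine ⟨a, fun x hx => ?_⟩
  by_contra! hxa
  have := ha x hxa.le
  rw [ProbabilityTheory.cdf_eq_real] at this
  exact absurd hx (not_le.2 this)

theorem nonempty_setOf_le_measure_Iic [IsProbabilityMeasure μ] {u : ℝ} (hu : u < 1) :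
    {x : ℝ | u ≤ (μ (Iic x)).toReal}.Nonempty := by
  obtain ⟨x, hx⟩ := ((ProbabilityTheory.tendsto_cdf_atTop μ).eventually_const_lt hu).exists
  rw [ProbabilityTheory.cdf_eq_real] at hx
  exact ⟨x, hx.le⟩

theorem quantile_le_iff [IsProbabilityMeasure μ] {u : ℝ} (hu : u ∈ Ioo (0 : ℝ) 1) (x : ℝ) :
    quantile μ u ≤ x ↔ u ≤ (μ (Iic x)).toReal := by
  refine ⟨fun h => ?_, fun h => csInf_le (bddBelow_setOf_le_measure_Iic hu.1) h⟩
  have hright := (ProbabilityTheory.cdf μ).right_continuous x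
  have htend : Tendsto (ProbabilityTheory.cdf μ) (nhdsWithin x (Ioi x))
      (nhds (ProbabilityTheory.cdf μ x)) := hright.mono_left (nhdsWithin_mono _ Ioi_subset_Ici_self)
  have key : u ≤ ProbabilityTheory.cdf μ x := by
    refine ge_of_tendsto htend ?_
    filter_upwards [self_mem_nhdsWithin] with y hy
    obtain ⟨z, hz, hzy⟩ :=
      exists_lt_of_csInf_lt (nonempty_setOf_le_measure_Iic hu.2) (lt_of_le_of_lt h hy)
    have hz' : u ≤ ProbabilityTheory.cdf μ z := by
      rw [ProbabilityTheory.cdf_eq_real]; exact hz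
    exact hz'.trans (ProbabilityTheory.monotone_cdf μ hzy.le)
  rwa [ProbabilityTheory.cdf_eq_real] at key

theorem monotoneOn_quantile [IsProbabilityMeasure μ] : MonotoneOn (quantile μ) (Ioo 0 1) :=
  fun _ hu _ hv huv =>
    (quantile_le_iff hu _).2 (huv.trans ((quantile_le_iff hv _).1 le_rfl))

theorem aemeasurable_quantile [IsProbabilityMeasure μ] :
    AEMeasurable (quantile μ) (volume.restrict (Ioo (0 : ℝ) 1)) :=
  aemeasurable_restrict_of_monotoneOn measurableSet_Ioo monotoneOn_quantile

theorem map_quantile [IsProbabilityMeasure μ] :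
    (volume.restrict (Ioo (0 : ℝ) 1)).map (quantile μ) = μ := by
  refine (Measure.ext_of_Iic _ _ fun x => ?_).symm
  rw [Measure.map_apply_of_aemeasurable aemeasurable_quantile measurableSet_Iic,
    Measure.restrict_apply' measurableSet_Ioo]
  have hset : quantile μ ⁻¹' Iic x ∩ Ioo 0 1 = Iic (μ (Iic x)).toReal ∩ Ioo 0 1 := by
    ext u
    simp only [mem_inter_iff, mem_preimage, mem_Iic]
    exact and_congr_left fun hu => quantile_le_iff hu x
  have hle : (μ (Iic x)).toReal ≤ 1 := measureReal_le_one
  have hae : (Iic (μ (Iic x)).toReal ∩ Ioo (0 : ℝ) 1 : Set ℝ)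
      =ᵐ[volume] Ioc 0 (μ (Iic x)).toReal := by
    have h1 : (Ioo (0 : ℝ) 1 : Set ℝ) =ᵐ[volume] Ioc 0 1 := Ioo_ae_eq_Ioc
    have h2 : Iic (μ (Iic x)).toReal ∩ Ioc (0 : ℝ) 1 = Ioc 0 (μ (Iic x)).toReal := by
      ext u
      simp only [mem_inter_iff, mem_Iic, mem_Ioc]
      exact ⟨fun h => ⟨h.2.1, h.1⟩, fun h => ⟨h.2, h.1, h.2.trans hle⟩⟩
    exact h2 ▸ (ae_eq_refl _).inter h1
  rw [hset, measure_congr hae, Real.volume_Ioc, sub_zero, ENNReal.ofReal_toReal (by finiteness)]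

theorem setIntegral_quantile [IsProbabilityMeasure μ] :
    ∫ u in Ioo (0 : ℝ) 1, quantile μ u = ∫ x, x ∂μ := by
  conv_rhs => rw [← map_quantile (μ := μ)]
  exact (integral_map aemeasurable_quantile aestronglyMeasurable_id).symm

theorem memLp_quantile [IsProbabilityMeasure μ] {p : ENNReal} (h : MemLp id p μ) :
    MemLp (quantile μ) p (volume.restrict (Ioo (0 : ℝ) 1)) := by
  rw [← map_quantile (μ := μ)] at h
  exact (memLp_map_measure_iff aestronglyMeasurable_id aemeasurable_quantile).1 h

theorem quantile_map_add_const [IsProbabilityMeasure μ] (c : ℝ) {u : ℝ}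
    (hu : u ∈ Ioo (0 : ℝ) 1) : quantile (μ.map (· + c)) u = quantile μ u + c := by
  have : IsProbabilityMeasure (μ.map (· + c)) :=
    Measure.isProbabilityMeasure_map (by fun_prop)
  refine eq_of_forall_ge_iff fun x => ?_
  rw [quantile_le_iff hu, ← le_sub_iff_add_le, quantile_le_iff hu,
    Measure.map_apply (by fun_prop) measurableSet_Iic]
  have : (· + c) ⁻¹' Iic x = Iic (x - c) := by ext; simp [le_sub_iff_add_le]
  rw [this]

end Quantile

section LogConcave

variable {f : ℝ → ℝ}

theorem measurable_of_logConcave (hf0 : ∀ x, 0 ≤ f x)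
    (hf : ∀ x y : ℝ, ∀ t ∈ Icc (0 : ℝ) 1, f x ^ (1 - t) * f y ^ t ≤ f ((1 - t) * x + t * y)) :
    Measurable f := by
  refine measurable_of_Ici fun a => ?_
  rcases le_or_gt a 0 with ha | ha
  · have : f ⁻¹' Ici a = univ := eq_univ_of_forall fun x => ha.trans (hf0 x)
    rw [this]
    exact MeasurableSet.univ
  · refine Set.OrdConnected.measurableSet (Convex.ordConnected ?_)
    intro x hx y hy s t hs ht hst
    obtain rfl : s = 1 - t := by linarith
    refine le_trans ?_ (hf x y t ⟨ht, by linarith⟩)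
    calc a = a ^ (1 - t) * a ^ t := by rw [← Real.rpow_add ha]; simp
      _ ≤ f x ^ (1 - t) * f y ^ t := by
        have hx' : a ≤ f x := hx
        have hy' : a ≤ f y := hy
        have := hf0 x
        gcongr

theorem logConcave_le_exp (hf0 : ∀ x, 0 ≤ f x)
    (hf : ∀ x y : ℝ, ∀ t ∈ Icc (0 : ℝ) 1, f x ^ (1 - t) * f y ^ t ≤ f ((1 - t) * x + t * y))
    {a b : ℝ} (hab : a < b) (hfab : f b < f a) :
    ∃ A c : ℝ, 0 < c ∧ ∀ x, b < x → f x ≤ A * Real.exp (-c * x) := by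
  have hfa : 0 < f a := (hf0 b).trans_lt hfab
  set p := (f a + f b) / 2 with hp
  have hp0 : 0 < p := by have := hf0 b; positivity
  have hpa : p < f a := by linarith
  have hlog : Real.log p < Real.log (f a) := Real.log_lt_log hp0 hpa
  set c := (Real.log (f a) - Real.log p) / (b - a) with hc
  have hba : 0 < b - a := sub_pos.2 hab
  refine ⟨f a * Real.exp (c * a), c, div_pos (sub_pos.2 hlog) hba, fun x hx => ?_⟩
  rw [mul_assoc, ← Real.exp_add]
  rcases (hf0 x).eq_or_lt with hfx | hfx
  · rw [← hfx]; positivity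
  have hxa : 0 < x - a := by linarith
  set t := (b - a) / (x - a) with ht
  have ht0 : 0 < t := div_pos hba hxa
  have ht1 : t ≤ 1 := (div_le_one hxa).2 (by linarith)
  have htx : t * (x - a) = b - a := div_mul_cancel₀ _ hxa.ne'
  have hbt : (1 - t) * a + t * x = b := by linarith
  have h := hf a x t ⟨ht0.le, ht1⟩
  rw [hbt] at h
  have h' := Real.log_le_log (by positivity) (h.trans (by linarith : f b ≤ p))
  rw [Real.log_mul (by positivity) (by positivity), Real.log_rpow hfa, Real.log_rpow hfx] at h'
  have hcb : c * (b - a) = Real.log (f a) - Real.log p := div_mul_cancel₀ _ hba.ne'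
  have hlogx : Real.log (f x) ≤ Real.log (f a) + (c * a + -c * x) := by
    refine le_of_mul_le_mul_left ?_ ht0
    have : t * (c * a + -c * x) = -(c * (b - a)) := by rw [← htx]; ring
    rw [mul_add, this, hcb]
    linarith
  rw [← Real.log_le_log_iff hfx (by positivity), Real.log_mul hfa.ne' (Real.exp_pos _).ne',
    Real.log_exp]
  exact hlogx

theorem exists_integrableOn_Ioi_sq_mul_of_logConcave (hf0 : ∀ x, 0 ≤ f x)
    (hf : ∀ x y : ℝ, ∀ t ∈ Icc (0 : ℝ) 1, f x ^ (1 - t) * f y ^ t ≤ f ((1 - t) * x + t * y))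
    (hfi : Integrable f) : ∃ b : ℝ, IntegrableOn (fun x => x ^ 2 * f x) (Ioi b) := by
  have hm := measurable_of_logConcave hf0 hf
  by_cases hz : ∀ x, f x = 0
  · exact ⟨0, by simp [hz]⟩
  push Not at hz
  obtain ⟨a, ha⟩ := hz
  have hfa : 0 < f a := lt_of_le_of_ne (hf0 a) ha.symm
  obtain ⟨b, hab, hfb⟩ : ∃ b, a < b ∧ f b < f a := by
    by_contra! hcon
    have hconst : IntegrableOn (fun _ : ℝ => f a) (Ioi a) := by
      refine Integrable.mono' hfi.integrableOn aestronglyMeasurable_const ?_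
      refine (ae_restrict_iff' measurableSet_Ioi).2 (ae_of_all _ fun x hx => ?_)
      rw [Real.norm_of_nonneg (hf0 a)]
      exact hcon x hx
    rw [integrableOn_const_iff] at hconst
    simp [ha] at hconst
  obtain ⟨A, c, hc, hbound⟩ := logConcave_le_exp hf0 hf hab hfb
  refine ⟨max b 0, ?_⟩
  have hexp : IntegrableOn (fun x : ℝ => A * (x ^ (2 : ℝ) * Real.exp (-c * x ^ (1 : ℝ))))
      (Ioi (max b 0)) :=
    ((integrableOn_rpow_mul_exp_neg_mul_rpow (by norm_num) one_pos hc).mono_set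
      (Ioi_subset_Ioi (le_max_right _ _))).const_mul A
  refine Integrable.mono' hexp (by fun_prop) ?_
  refine (ae_restrict_iff' measurableSet_Ioi).2 (ae_of_all _ fun x hx => ?_)
  have hbx := hbound x ((le_max_left _ _).trans_lt hx)
  have hfx := hf0 x
  rw [Real.norm_of_nonneg (by positivity), Real.rpow_two, Real.rpow_one]
  calc x ^ 2 * f x ≤ x ^ 2 * (A * Real.exp (-c * x)) := by gcongr
    _ = _ := by ring

theorem integrable_sq_mul_of_logConcave (hf0 : ∀ x, 0 ≤ f x)
    (hf : ∀ x y : ℝ, ∀ t ∈ Icc (0 : ℝ) 1, f x ^ (1 - t) * f y ^ t ≤ f ((1 - t) * x + t * y))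
    (hfi : Integrable f) : Integrable (fun x => x ^ 2 * f x) := by
  obtain ⟨b, hb⟩ := exists_integrableOn_Ioi_sq_mul_of_logConcave hf0 hf hfi
  obtain ⟨a, ha⟩ := exists_integrableOn_Ioi_sq_mul_of_logConcave (f := fun x => f (-x))
    (fun x => hf0 _) (fun x y t ht => by
      have := hf (-x) (-y) t ht
      rwa [show (1 - t) * -x + t * -y = -((1 - t) * x + t * y) by ring] at this) hfi.comp_neg
  have ha' : IntegrableOn (fun x => x ^ 2 * f x) (Iio (-a)) := by
    have h : IntegrableOn (fun x => (-x) ^ 2 * f (- -x)) (Iio (-a)) :=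
      IntegrableOn.comp_neg_Iio (f := fun x => x ^ 2 * f (-x)) (c := -a) (by rwa [neg_neg])
    simpa only [neg_sq, neg_neg] using h
  have hmid : IntegrableOn (fun x => x ^ 2 * f x) (Icc (-a) b) :=
    hfi.integrableOn.continuousOn_mul (by fun_prop) isCompact_Icc
  rw [← integrableOn_univ]
  refine ((ha'.union hmid).union hb).mono_set fun x _ => ?_
  rcases lt_or_ge x (-a) with h | h
  · exact Or.inl (Or.inl h)
  · rcases le_or_gt x b with h' | h'
    · exact Or.inl (Or.inr ⟨h, h'⟩)
    · exact Or.inr h'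

theorem memLp_id_of_mem_Flc {μ : Measure ℝ} (hμ : μ ∈ Flc) : MemLp id 2 μ := by
  obtain ⟨hprob, ⟨x, rfl⟩ | ⟨f, hf0, rfl, hf⟩⟩ := hμ
  · exact (memLp_const x).ae_eq (by simp [EventuallyEq, ae_dirac_eq])
  · have hm := measurable_of_logConcave hf0 hf
    have hfi : Integrable f := by
      refine ⟨hm.aestronglyMeasurable, ?_⟩
      rw [hasFiniteIntegral_iff_ofReal (ae_of_all _ hf0)]
      have := hprob.measure_univ
      rw [withDensity_apply _ MeasurableSet.univ, Measure.restrict_univ] at this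
      simp [this]
    refine (memLp_two_iff_integrable_sq aestronglyMeasurable_id).2 ?_
    rw [integrable_withDensity_iff hm.ennreal_ofReal (by simp)]
    refine (integrable_sq_mul_of_logConcave hf0 hf hfi).congr (ae_of_all _ fun x => ?_)
    simp [ENNReal.toReal_ofReal (hf0 x)]

theorem map_add_const_mem_Flc {μ : Measure ℝ} (hμ : μ ∈ Flc) (c : ℝ) :
    μ.map (· + c) ∈ Flc := by
  obtain ⟨hprob, hμ⟩ := hμ
  refine ⟨Measure.isProbabilityMeasure_map (by fun_prop), ?_⟩
  obtain ⟨x, rfl⟩ | ⟨f, hf0, rfl, hf⟩ := hμ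
  · exact Or.inl ⟨x + c, Measure.map_dirac' (by fun_prop) x⟩
  · refine Or.inr ⟨fun x => f (x - c), fun x => hf0 _, ?_, fun x y t ht => ?_⟩
    · have hm := measurable_of_logConcave hf0 hf
      ext s hs
      rw [Measure.map_apply (by fun_prop) hs, withDensity_apply _ hs,
        withDensity_apply _ (hs.preimage (by fun_prop)),
        ← (measurePreserving_add_right volume c).setLIntegral_comp_preimage hs (by fun_prop)]
      simp
    · have := hf (x - c) (y - c) t ht
      rwa [show (1 - t) * (x - c) + t * (y - c) = (1 - t) * x + t * y - c by ring] at this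

end LogConcave

/-- Example 4.3, centering. For every `μ ∈ P_2(ℝ)`, the log-concave
Wasserstein projection `μhat` of `μ` (the minimizer of `ν ↦ W_2(ν, μ)` over `F_lc`)
has the same mean as `μ`. -/
theorem wasserstein_projection_logConcave_mean
    (μ : MeasureTheory.Measure ℝ) (hμ : HasFiniteMomentP 2 μ)
    (μhat : MeasureTheory.Measure ℝ)
    (hμhatF : μhat ∈ Flc)
    (hμhatmin : ∀ ν ∈ Flc, Wdist 2 μhat μ ≤ Wdist 2 ν μ) :
    ∫ x, x ∂μhat = ∫ x, x ∂μ := by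
  have hprob : IsProbabilityMeasure μ := hμ.1
  have hprobhat : IsProbabilityMeasure μhat := hμhatF.1
  have hLμ : MemLp id 2 μ := by
    refine (memLp_two_iff_integrable_sq aestronglyMeasurable_id).2 ?_
    simpa using hμ.2
  have hQ := memLp_quantile hLμ
  have hQhat := memLp_quantile (memLp_id_of_mem_Flc hμhatF)
  set g : ℝ → ℝ := fun u => quantile μhat u - quantile μ u with hg
  have hg2 : MemLp g 2 (volume.restrict (Ioo (0 : ℝ) 1)) := hQhat.sub hQ
  have hgi : IntegrableOn g (Ioo (0 : ℝ) 1) := hg2.integrable one_le_two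
  have hgsq : IntegrableOn (fun u => g u ^ 2) (Ioo (0 : ℝ) 1) := hg2.integrable_sq
  have hmin : ∀ c : ℝ, 0 ≤ 2 * c * (∫ u in Ioo (0 : ℝ) 1, g u) + c ^ 2 := by
    intro c
    have h := hμhatmin _ (map_add_const_mem_Flc hμhatF c)
    unfold Wdist at h
    rw [Real.rpow_le_rpow_iff (integral_nonneg fun _ => by positivity)
      (integral_nonneg fun _ => by positivity) (by norm_num)] at h
    have h1 : ∫ u in Ioo (0 : ℝ) 1, |quantile μhat u - quantile μ u| ^ (2 : ℝ)
        = ∫ u in Ioo (0 : ℝ) 1, g u ^ 2 := by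
      simp [hg]
    have h2 : ∫ u in Ioo (0 : ℝ) 1, |quantile (μhat.map (· + c)) u - quantile μ u| ^ (2 : ℝ)
        = ∫ u in Ioo (0 : ℝ) 1, (g u ^ 2 + (2 * c * g u + c ^ 2)) := by
      refine setIntegral_congr_fun measurableSet_Ioo fun u hu => ?_
      simp only [quantile_map_add_const c hu, Real.rpow_two, sq_abs, hg]
      ring
    have hlin : IntegrableOn (fun u => 2 * c * g u + c ^ 2) (Ioo (0 : ℝ) 1) :=
      (hgi.const_mul _).add (integrable_const _)
    rw [h1, h2, integral_add hgsq hlin,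
      integral_add (hgi.const_mul _) (integrable_const _), integral_const_mul] at h
    simp at h
    linarith
  have hzero : ∫ u in Ioo (0 : ℝ) 1, g u = 0 := by
    have := hmin (-∫ u in Ioo (0 : ℝ) 1, g u)
    nlinarith [sq_nonneg (∫ u in Ioo (0 : ℝ) 1, g u)]
  rw [integral_sub (hQhat.integrable one_le_two) (hQ.integrable one_le_two),
    setIntegral_quantile, setIntegral_quantile] at hzero
  exact sub_eq_zero.1 hzero
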